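/- arXiv:math/0310011 — 2 statements merged into one kernel-verified Lean document; each statement's English description precedes it below -/
import Mathlib

section
/- In the BMW algebra B of a spherical simply laced Coxeter diagram M with N = |Φ⁺| positive roots, every product of generators g_i, g_i^{-1}, e_i of length greater than N is equal to a Q(l,x)-linear combination of such products of strictly smaller length; consequently B is finite dimensional, spanned by products of length at most N. -/
noncomputable section

/-- The base field ℚ(l,x): rational functions in two variables over ℚ. -/
abbrev BMWField : Type := FractionRing (MvPolynomial (Fin 2) ℚ)

/-- The parameter `l`. -/
def lP : BMWField := algebraMap (MvPolynomial (Fin 2) ℚ) BMWField (MvPolynomial.X 0)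

/-- The parameter `x`. -/
def xP : BMWField := algebraMap (MvPolynomial (Fin 2) ℚ) BMWField (MvPolynomial.X 1)

/-- The parameter `m = (l - l⁻¹)/(1 - x)`. -/
def mP : BMWField := (lP - lP⁻¹) / (1 - xP)

/-- The free algebra on generators `g_i` (left summand) and `e_i` (right summand). -/
abbrev BMWFree (n : ℕ) : Type := FreeAlgebra BMWField (Fin n ⊕ Fin n)

/-- The generator `g_i` of the free algebra. -/
def Gf (n : ℕ) (i : Fin n) : BMWFree n := FreeAlgebra.ι BMWField (Sum.inl i)

/-- The generator `e_i` of the free algebra. -/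
def Ef (n : ℕ) (i : Fin n) : BMWFree n := FreeAlgebra.ι BMWField (Sum.inr i)

/-- The defining relations (B1), (B2), (D1), (R1), (R2) of the BMW algebra of a
simply laced diagram on `n` nodes with adjacency relation `adj`. -/
inductive BMWRel (n : ℕ) (adj : Fin n → Fin n → Prop) : BMWFree n → BMWFree n → Prop
  | comm (i j : Fin n) (hne : i ≠ j) (h : ¬ adj i j) :
      BMWRel n adj (Gf n i * Gf n j) (Gf n j * Gf n i)
  | braid (i j : Fin n) (h : adj i j) :
      BMWRel n adj (Gf n i * Gf n j * Gf n i) (Gf n j * Gf n i * Gf n j)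
  | defE (i : Fin n) :
      BMWRel n adj (mP • Ef n i) (lP • (Gf n i * Gf n i + mP • Gf n i - 1))
  | ge (i : Fin n) :
      BMWRel n adj (Gf n i * Ef n i) (lP⁻¹ • Ef n i)
  | ege (i j : Fin n) (h : adj i j) :
      BMWRel n adj (Ef n i * Gf n j * Ef n i) (lP • Ef n i)

/-- The BMW algebra of the diagram, over ℚ(l,x). -/
abbrev BMW (n : ℕ) (adj : Fin n → Fin n → Prop) : Type := RingQuot (BMWRel n adj)

/-- The generator `g_i` of the BMW algebra. -/
def gg (n : ℕ) (adj : Fin n → Fin n → Prop) (i : Fin n) : BMW n adj :=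
  RingQuot.mkAlgHom BMWField (BMWRel n adj) (Gf n i)

/-- The generator `e_i` of the BMW algebra. -/
def ee (n : ℕ) (adj : Fin n → Fin n → Prop) (i : Fin n) : BMW n adj :=
  RingQuot.mkAlgHom BMWField (BMWRel n adj) (Ef n i)

/-- The set of standard monomial letters `g_i`, `e_i`, `g_i⁻¹` in the BMW algebra. -/
def BMWGens (n : ℕ) (adj : Fin n → Fin n → Prop) : Set (BMW n adj) :=
  {b | ∃ i : Fin n, b = gg n adj i ∨ b = ee n adj i ∨ b = Ring.inverse (gg n adj i)}


namespace CoxeterMatrix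

variable {B : Type*}

/-- A Coxeter matrix is simply laced if its off-diagonal entries are `2` or `3`. -/
def IsSimplyLaced (M : CoxeterMatrix B) : Prop :=
  ∀ i j : B, i ≠ j → M i j = 2 ∨ M i j = 3

/-- Equality of words up to the simply laced braid moves attached to the adjacency relation `adj`. -/
inductive BraidEquiv (adj : B → B → Prop) : List B → List B → Prop
  | refl (ω : List B) : BraidEquiv adj ω ω
  | trans {ω₁ ω₂ ω₃ : List B} :
      BraidEquiv adj ω₁ ω₂ → BraidEquiv adj ω₂ ω₃ → BraidEquiv adj ω₁ ω₃
  | cons (i : B) {ω₁ ω₂ : List B} : BraidEquiv adj ω₁ ω₂ → BraidEquiv adj (i :: ω₁) (i :: ω₂)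
  | comm (i j : B) (ω : List B) (hne : i ≠ j) (h : ¬ adj i j) :
      BraidEquiv adj (i :: j :: ω) (j :: i :: ω)
  | braid (i j : B) (ω : List B) (h : adj i j) :
      BraidEquiv adj (i :: j :: i :: ω) (j :: i :: j :: ω)

theorem BraidEquiv.length_eq {adj : B → B → Prop} {ω₁ ω₂ : List B}
    (h : BraidEquiv adj ω₁ ω₂) : ω₁.length = ω₂.length := by
  induction h <;> simp_all

end CoxeterMatrix

namespace CoxeterSystem

open CoxeterMatrix List

section ReflectionParity

open scoped Classical in
/-- The action of an involution `a` of a group on signed elements: conjugation by `a`, with a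
change of sign exactly at `a`. -/
def signedConj {G : Type*} [Group G] (a : G) : Function.End (G × ZMod 2) :=
  fun p ↦ (a * p.1 * a⁻¹, p.2 + if p.1 = a then 1 else 0)

variable {G : Type*} [Group G] {a b : G}

theorem signedConj_apply (p : G × ZMod 2) [Decidable (p.1 = a)] :
    signedConj a p = (a * p.1 * a⁻¹, p.2 + if p.1 = a then 1 else 0) := by
  unfold signedConj
  congr

theorem signedConj_mul_self (ha : a * a = 1) : signedConj a * signedConj a = 1 := by
  classical
  have ha' : a⁻¹ = a := inv_eq_of_mul_eq_one_left ha
  have h2 : ∀ x y : ZMod 2, x + y + y = x := by decide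
  funext ⟨t, ε⟩
  have h : a * t * a = a ↔ t = a := by grind
  change signedConj a (signedConj a (t, ε)) = (t, ε)
  simp only [signedConj_apply, ha', h, h2]
  grind

theorem signedConj_mul_pow_two (ha : a * a = 1) (hb : b * b = 1) (hab : (a * b) ^ 2 = 1) :
    (signedConj a * signedConj b) ^ 2 = 1 := by
  classical
  have ha' : a⁻¹ = a := inv_eq_of_mul_eq_one_left ha
  have hb' : b⁻¹ = b := inv_eq_of_mul_eq_one_left hb
  have hc : a * b = b * a := by
    rw [pow_two] at hab
    rw [← inv_eq_of_mul_eq_one_left hab, mul_inv_rev, ha', hb']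
  have h2 : ∀ x y z : ZMod 2, x + y + z + y + z = x := by decide
  rw [pow_two]
  funext ⟨t, ε⟩
  have h1 : b * t * b = a ↔ t = a := by grind
  have h3 : a * (b * t * b) * a = b ↔ t = b := by grind
  have h4 : b * (a * (b * t * b) * a) * b = a ↔ t = a := by grind
  change signedConj a (signedConj b (signedConj a (signedConj b (t, ε)))) = (t, ε)
  simp only [signedConj_apply, ha', hb', h1, h3, h4, h2]
  grind

theorem signedConj_mul_pow_three (ha : a * a = 1) (hb : b * b = 1) (hab : (a * b) ^ 3 = 1) :
    (signedConj a * signedConj b) ^ 3 = 1 := by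
  classical
  have ha' : a⁻¹ = a := inv_eq_of_mul_eq_one_left ha
  have hb' : b⁻¹ = b := inv_eq_of_mul_eq_one_left hb
  have hc : a * b * a = b * a * b := by
    rw [pow_three] at hab
    have : a * b * a * (b * a * b) = 1 := by simpa only [mul_assoc] using hab
    rw [eq_inv_of_mul_eq_one_left this]
    simp only [mul_inv_rev, ha', hb', mul_assoc]
  have h2 : ∀ x y z w : ZMod 2, x + y + z + w + y + z + w = x := by decide
  rw [pow_three]
  funext ⟨t, ε⟩
  have h1 : b * t * b = a ↔ t = b * a * b := by grind
  have h3 : a * (b * t * b) * a = b ↔ t = a := by grind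
  have h4 : b * (a * (b * t * b) * a) * b = a ↔ t = b := by grind
  have h5 : a * (b * (a * (b * t * b) * a) * b) * a = b ↔ t = b * a * b := by grind
  have h6 : b * (a * (b * (a * (b * t * b) * a) * b) * a) * b = a ↔ t = a := by grind
  change signedConj a (signedConj b (signedConj a (signedConj b (signedConj a
    (signedConj b (t, ε)))))) = (t, ε)
  simp only [signedConj_apply, ha', hb', h1, h3, h4, h5, h6, h2]
  grind

end ReflectionParity

variable {B W : Type*} [Group W] {M : CoxeterMatrix B} (cs : CoxeterSystem M W)

theorem isLiftable_signedConj (hM : M.IsSimplyLaced) :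
    M.IsLiftable fun i ↦ signedConj (cs.simple i) := by
  intro i j
  have hi := cs.simple_mul_simple_self i
  have hj := cs.simple_mul_simple_self j
  have hij := cs.simple_mul_simple_pow i j
  rcases eq_or_ne i j with rfl | hne
  · simpa using signedConj_mul_self hi
  · rcases hM i j hne with h | h <;> rw [h] at hij ⊢
    · exact signedConj_mul_pow_two hi hj hij
    · exact signedConj_mul_pow_three hi hj hij

open scoped Classical in
theorem lift_signedConj_wordProd (hM : M.IsSimplyLaced) (ω : List B) (t : W) (ε : ZMod 2) :
    cs.lift ⟨_, cs.isLiftable_signedConj hM⟩ (cs.wordProd ω) (t, ε) =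
      (cs.wordProd ω * t * (cs.wordProd ω)⁻¹, ε + (cs.rightInvSeq ω).count t) := by
  induction ω with
  | nil => simp [Function.End.one_def]
  | cons i ω ih =>
    rw [wordProd_cons, map_mul, lift_apply_simple]
    change signedConj (cs.simple i) (cs.lift ⟨_, cs.isLiftable_signedConj hM⟩
      (cs.wordProd ω) (t, ε)) = _
    rw [ih, rightInvSeq, count_cons, signedConj_apply]
    have h : cs.wordProd ω * t * (cs.wordProd ω)⁻¹ = cs.simple i ↔
        (cs.wordProd ω)⁻¹ * cs.simple i * cs.wordProd ω = t := by
      constructor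
      · intro h; rw [← h]; group
      · intro h; rw [← h]; group
    simp only [h, beq_iff_eq, mul_inv_rev, Nat.cast_add, Nat.cast_ite, Nat.cast_one, Nat.cast_zero]
    simp only [mul_assoc, add_assoc]

open scoped Classical in
theorem count_leftInvSeq_eq_of_wordProd_eq (hM : M.IsSimplyLaced) {ω ω' : List B}
    (h : cs.wordProd ω = cs.wordProd ω') (t : W) :
    ((cs.leftInvSeq ω).count t : ZMod 2) = (cs.leftInvSeq ω').count t := by
  have key : ∀ ω : List B, ((cs.leftInvSeq ω).count t : ZMod 2) =
      (cs.lift ⟨_, cs.isLiftable_signedConj hM⟩ (cs.wordProd ω)⁻¹ (t, 0)).2 := by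
    intro ω
    rw [← wordProd_reverse, cs.lift_signedConj_wordProd hM, rightInvSeq_reverse, count_reverse, zero_add]
  rw [key, key, h]

/-- The exchange property of simply laced Coxeter systems. -/
theorem exists_eraseIdx_of_isLeftDescent (hM : M.IsSimplyLaced) {ω : List B} {i : B}
    (h : cs.IsLeftDescent (cs.wordProd ω) i) :
    ∃ k < ω.length, cs.simple i * cs.wordProd ω = cs.wordProd (ω.eraseIdx k) := by
  classical
  obtain ⟨ω', hω', hprod⟩ := cs.exists_isReduced (cs.simple i * cs.wordProd ω)
  have hw : cs.wordProd ω = cs.wordProd (i :: ω') := by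
    rw [wordProd_cons, ← hprod, simple_mul_simple_cancel_left]
  have hred : cs.IsReduced (i :: ω') := by
    rw [isLeftDescent_iff] at h
    rw [IsReduced, ← hw, ← h, hprod, hω'.eq, length_cons]
  have hcount : (cs.leftInvSeq (i :: ω')).count (cs.simple i) = 1 :=
    count_eq_one_of_mem hred.nodup_leftInvSeq (by simp [leftInvSeq])
  have hmem : cs.simple i ∈ cs.leftInvSeq ω := by
    by_contra hnot
    have := cs.count_leftInvSeq_eq_of_wordProd_eq hM hw (cs.simple i)
    rw [hcount, count_eq_zero_of_not_mem hnot] at this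
    exact absurd this (by decide)
  obtain ⟨k, hk, hki⟩ := mem_iff_getElem.mp hmem
  refine ⟨k, by simpa using hk, ?_⟩
  rw [← getD_leftInvSeq_mul_wordProd, getD_eq_getElem _ 1 hk, hki]

open scoped Classical in
/-- The action of a simple reflection on integral weights. -/
def weightReflection (M : CoxeterMatrix B) (i : B) : Function.End (B → ℤ) :=
  fun φ k ↦ φ k - (if i = k then 2 else if M i k = 3 then -1 else 0) * φ i

theorem isLiftable_weightReflection (hM : M.IsSimplyLaced) :
    M.IsLiftable (weightReflection M) := by
  intro i j
  rcases eq_or_ne i j with rfl | hne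
  · rw [M.diagonal, pow_one]
    funext φ k
    change weightReflection M i (weightReflection M i φ) k = φ k
    simp only [weightReflection, if_true]
    ring
  · have hs := M.symmetric i j
    rcases hM i j hne with h | h <;> rw [h] at hs ⊢ <;> funext φ k
    · rw [pow_two]
      change weightReflection M i (weightReflection M j (weightReflection M i
        (weightReflection M j φ))) k = φ k
      simp only [weightReflection, if_true, hne, hne.symm, if_false, h, ← hs,
        (by decide : ¬ (2 : ℕ) = 3)]
      ring
    · rw [pow_three]
      change weightReflection M i (weightReflection M j (weightReflection M i
        (weightReflection M j (weightReflection M i (weightReflection M j φ))))) k = φ k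
      simp only [weightReflection, if_true, hne, hne.symm, if_false, h, ← hs]
      ring

theorem simple_injective (hM : M.IsSimplyLaced) : Function.Injective cs.simple := by
  classical
  intro i j hij
  by_contra hne
  have h := congrArg (cs.lift ⟨_, isLiftable_weightReflection hM⟩) hij
  rw [lift_apply_simple, lift_apply_simple] at h
  have := congrFun (congrFun h (Pi.single i 1)) i
  simp [weightReflection, Ne.symm hne] at this

variable {cs} in
theorem IsReduced.of_cons {i : B} {ω : List B} (h : cs.IsReduced (i :: ω)) : cs.IsReduced ω :=
  h.drop 1

variable {cs} in
theorem IsReduced.isLeftDescent_cons {i : B} {ω : List B} (h : cs.IsReduced (i :: ω)) :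
    cs.IsLeftDescent (cs.wordProd (i :: ω)) i := by
  rw [IsLeftDescent, h.eq, wordProd_cons, simple_mul_simple_cancel_left, h.of_cons.eq]
  simp

theorem isReduced_of_wordProd_eq {ω ω' : List B} (h : cs.IsReduced ω)
    (hprod : cs.wordProd ω' = cs.wordProd ω) (hlen : ω'.length = ω.length) : cs.IsReduced ω' := by
  rw [IsReduced, hprod, h.eq, hlen]

/-- A left descent different from the first letter of a reduced word `j :: ω` can be exchanged
against a letter of `ω`. -/
theorem exists_wordProd_eq_cons_cons (hM : M.IsSimplyLaced) {i j : B} (hne : i ≠ j) {ω : List B}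
    (h : cs.IsLeftDescent (cs.wordProd (j :: ω)) i) :
    ∃ ω', ω'.length + 1 = ω.length ∧ cs.wordProd (j :: ω) = cs.wordProd (i :: j :: ω') := by
  obtain ⟨k, hk, hprod⟩ := cs.exists_eraseIdx_of_isLeftDescent hM h
  cases k with
  | zero =>
    rw [eraseIdx_cons_zero, wordProd_cons, ← mul_assoc, mul_eq_right] at hprod
    refine absurd (cs.simple_injective hM ?_) hne
    rw [eq_inv_of_mul_eq_one_left hprod, inv_simple]
  | succ k =>
    rw [eraseIdx_cons_succ] at hprod
    refine ⟨ω.eraseIdx k, length_eraseIdx_add_one (by simpa using hk), ?_⟩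
    rw [wordProd_cons _ i, ← hprod, simple_mul_simple_cancel_left]

/-- Matsumoto's theorem for simply laced Coxeter systems. -/
theorem braidEquiv_of_isReduced (hM : M.IsSimplyLaced) {adj : B → B → Prop}
    (hadj : ∀ i j, adj i j ↔ i ≠ j ∧ M i j = 3) {ω ω' : List B} (hω : cs.IsReduced ω)
    (hω' : cs.IsReduced ω') (h : cs.wordProd ω = cs.wordProd ω') : BraidEquiv adj ω ω' := by
  induction hn : ω.length using Nat.strong_induction_on generalizing ω ω' with
  | _ n ih =>
  have hlen : ω.length = ω'.length := by rw [← hω.eq, ← hω'.eq, h]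
  rcases ω with _ | ⟨i, u⟩ <;> rcases ω' with _ | ⟨j, v⟩
  · exact .refl _
  · simp at hlen
  · simp at hlen
  have ihcons : ∀ {k : B} {u v : List B}, u.length < n → cs.IsReduced (k :: u) →
      cs.wordProd (k :: v) = cs.wordProd (k :: u) → v.length = u.length →
      BraidEquiv adj (k :: u) (k :: v) := by
    intro k u v hlt hu hprod hl
    refine .cons k (ih _ hlt hu.of_cons ?_ ?_ rfl)
    · exact (cs.isReduced_of_wordProd_eq hu hprod (by simp [hl])).of_cons
    · simpa [wordProd_cons] using hprod.symm
  simp only [length_cons] at hn hlen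
  rcases eq_or_ne i j with rfl | hne
  · exact ihcons (by lia) hω h.symm (by lia)
  obtain ⟨p, hp, hpprod⟩ := cs.exists_wordProd_eq_cons_cons hM hne (h ▸ hω.isLeftDescent_cons)
  have hup : BraidEquiv adj (i :: u) (i :: j :: p) :=
    ihcons (by lia) hω (by rw [h, hpprod]) (by simp; lia)
  rcases hM i j hne with hm | hm
  · have hnadj : ¬ adj i j := by simp [hadj, hm]
    refine hup.trans (.trans (.comm i j p hne hnadj) ?_)
    have hcomm : cs.wordProd (j :: i :: p) = cs.wordProd (j :: v) := by
      have hsq := cs.simple_mul_simple_pow i j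
      rw [hm, pow_two] at hsq
      have hij : cs.simple i * cs.simple j = cs.simple j * cs.simple i := by
        rw [eq_inv_of_mul_eq_one_left hsq, mul_inv_rev, inv_simple, inv_simple]
      rw [hpprod]
      simp only [wordProd_cons, ← mul_assoc, hij]
    exact ihcons (by simp; lia) (cs.isReduced_of_wordProd_eq hω' hcomm (by simp; lia)) hcomm.symm
      (by simp; lia)
  · have hbr : cs.simple i * cs.simple j * cs.simple i =
        cs.simple j * cs.simple i * cs.simple j := by
      have hcube := cs.simple_mul_simple_pow i j
      rw [hm, pow_three] at hcube
      have : cs.simple i * cs.simple j * cs.simple i *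
          (cs.simple j * cs.simple i * cs.simple j) = 1 := by
        simpa only [mul_assoc] using hcube
      rw [eq_inv_of_mul_eq_one_left this]
      simp only [mul_inv_rev, inv_simple, mul_assoc]
    have hne_one : cs.simple j * cs.simple i ≠ 1 := fun h1 ↦
      hne.symm (cs.simple_injective hM (by rw [eq_inv_of_mul_eq_one_left h1, inv_simple]))
    have hdesc : cs.IsLeftDescent (cs.wordProd (i :: j :: p)) j :=
      hpprod ▸ hω'.isLeftDescent_cons
    obtain ⟨k, hk, hprod⟩ := cs.exists_eraseIdx_of_isLeftDescent hM hdesc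
    obtain ⟨q, hq, hqprod⟩ : ∃ q : List B, q.length + 1 = p.length ∧
        cs.simple j * cs.wordProd (i :: j :: p) = cs.wordProd (i :: j :: q) := by
      rcases k with _ | _ | k
      · refine absurd ?_ hne_one
        simpa [wordProd_cons, ← mul_assoc] using hprod
      · refine absurd ?_ hne_one
        have : cs.simple j * cs.simple i * cs.simple j = cs.simple i := by
          simpa [wordProd_cons, ← mul_assoc] using hprod
        rw [← hbr] at this
        simpa [mul_assoc] using this
      · exact ⟨p.eraseIdx k, length_eraseIdx_add_one (by simpa using hk), hprod⟩
    have hj : cs.wordProd (i :: j :: p) = cs.wordProd (j :: i :: j :: q) := by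
      rw [wordProd_cons _ j, ← hqprod, simple_mul_simple_cancel_left]
    have hi : cs.wordProd (j :: i :: j :: q) = cs.wordProd (i :: j :: i :: q) := by
      simp only [wordProd_cons, ← mul_assoc, hbr]
    have hpq : BraidEquiv adj (i :: j :: p) (i :: j :: i :: q) :=
      ihcons (by simp; lia) (cs.isReduced_of_wordProd_eq hω' hpprod.symm (by simp; lia))
        (by rw [hj, hi]) (by simp; lia)
    have hqprod' : cs.wordProd (j :: i :: j :: q) = cs.wordProd (j :: v) := by rw [hpprod, hj]
    exact hup.trans (hpq.trans (.trans (.braid i j q ((hadj i j).mpr ⟨hne, hm⟩))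
      (ihcons (by simp; lia) (cs.isReduced_of_wordProd_eq hω' hqprod' (by simp; lia))
        hqprod'.symm (by simp; lia))))

/-- Tits' solution of the word problem for simply laced Coxeter systems: a word that is not reduced
is equivalent under braid moves to one with two equal consecutive letters. -/
theorem exists_braidEquiv_of_not_isReduced (hM : M.IsSimplyLaced) {adj : B → B → Prop}
    (hadj : ∀ i j, adj i j ↔ i ≠ j ∧ M i j = 3) {ω : List B} (hω : ¬ cs.IsReduced ω) :
    ∃ (u : List B) (i : B) (v : List B), BraidEquiv adj ω (u ++ i :: i :: v) := by
  induction ω with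
  | nil => simp [IsReduced] at hω
  | cons i ω ih =>
    by_cases hred : cs.IsReduced ω
    · have hdesc : cs.IsLeftDescent (cs.wordProd ω) i := by
        by_contra hnot
        rw [not_isLeftDescent_iff, ← wordProd_cons, hred.eq] at hnot
        exact hω (by rw [IsReduced, hnot, length_cons])
      obtain ⟨v, hv, hprod⟩ := cs.exists_isReduced (cs.simple i * cs.wordProd ω)
      have hωv : cs.wordProd ω = cs.wordProd (i :: v) := by
        rw [wordProd_cons, ← hprod, simple_mul_simple_cancel_left]
      rw [isLeftDescent_iff, hprod, hv.eq, hred.eq] at hdesc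
      exact ⟨[], i, v, .cons i (cs.braidEquiv_of_isReduced hM hadj hred
        (cs.isReduced_of_wordProd_eq hred hωv.symm (by simp [hdesc])) hωv)⟩
    · obtain ⟨u, k, v, h⟩ := ih hred
      exact ⟨i :: u, k, v, h.cons i⟩

end CoxeterSystem

/-- Families `g`, `e` in a `K`-algebra satisfying the relations of the BMW algebra of the simply
laced diagram with adjacency relation `adj`. -/
structure IsBMWFamily {K A ι : Type*} [Field K] [Ring A] [Algebra K A] (l x m : K)
    (adj : ι → ι → Prop) (g e : ι → A) : Prop where
  l_ne_zero : l ≠ 0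
  m_ne_zero : m ≠ 0
  one_add_ne_zero : 1 + l * m ≠ 0
  m_mul : m * (1 - x) = l - l⁻¹
  symm : ∀ {i j}, adj i j → adj j i
  comm : ∀ {i j}, i ≠ j → ¬ adj i j → g i * g j = g j * g i
  braid : ∀ {i j}, adj i j → g i * g j * g i = g j * g i * g j
  defE : ∀ i, m • e i = l • (g i * g i + m • g i - 1)
  ge : ∀ i, g i * e i = l⁻¹ • e i
  ege : ∀ {i j}, adj i j → e i * g j * e i = l • e i

namespace IsBMWFamily

variable {K A ι : Type*} [Field K] [Ring A] [Algebra K A] {l x m : K} {adj : ι → ι → Prop}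
  {g e : ι → A} (H : IsBMWFamily l x m adj g e) {i j : ι}

section Relations

include H

theorem e_eq (i : ι) : e i = (m⁻¹ * l) • (g i * g i + m • g i - 1) := by
  rw [mul_smul, ← H.defE, inv_smul_smul₀ H.m_ne_zero]

theorem g_mul_g (i : ι) : g i * g i = 1 - m • g i + (m * l⁻¹) • e i := by
  have h : (l⁻¹ * m) • e i = g i * g i + m • g i - 1 := by
    rw [mul_smul, H.defE, inv_smul_smul₀ H.l_ne_zero]
  rw [mul_comm m, h]
  abel

theorem commute_e {a : A} (h : Commute a (g i)) : Commute a (e i) := by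
  rw [H.e_eq]
  exact (((h.mul_right h).add_right (h.smul_right m)).sub_right (.one_right a)).smul_right _

theorem e_mul_g (i : ι) : e i * g i = l⁻¹ • e i := by
  rw [← H.ge, (H.commute_e (Commute.refl (g i))).eq]

theorem e_mul_e (i : ι) : e i * e i = x • e i := by
  have h : m • (e i * e i) = (m * x) • e i := by
    have hmx : m * x = m - l + l⁻¹ := by linear_combination -H.m_mul
    have hl := H.l_ne_zero
    rw [← mul_smul_comm, H.defE, hmx, mul_smul_comm, mul_sub, mul_add, mul_one, mul_smul_comm,
      ← mul_assoc, H.e_mul_g, smul_mul_assoc, H.e_mul_g]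
    match_scalars
    field_simp
    ring
  rw [mul_smul] at h
  exact smul_right_injective A H.m_ne_zero h

end Relations

/-- The inverse of the generator `g i`. -/
def gInv (m : K) (g e : ι → A) (i : ι) : A := g i + m • (1 : A) - m • e i

section Inverse

include H

theorem g_mul_gInv (i : ι) : g i * gInv m g e i = 1 := by
  rw [gInv, mul_sub, mul_add, mul_smul_comm, mul_smul_comm, H.ge, H.g_mul_g, mul_one]
  module

theorem gInv_mul_g (i : ι) : gInv m g e i * g i = 1 := by
  rw [gInv, sub_mul, add_mul, smul_mul_assoc, smul_mul_assoc, H.e_mul_g, H.g_mul_g, one_mul]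
  module

theorem gInv_mul_g_assoc (i : ι) (a : A) : gInv m g e i * (g i * a) = a := by
  rw [← mul_assoc, H.gInv_mul_g, one_mul]

theorem mul_g_mul_gInv (i : ι) (a : A) : a * g i * gInv m g e i = a := by
  rw [mul_assoc, H.g_mul_gInv, mul_one]

theorem e_mul_gInv (i : ι) : e i * gInv m g e i = l • e i := by
  have h : l • (e i * g i) * gInv m g e i = e i * gInv m g e i := by
    rw [H.e_mul_g, smul_inv_smul₀ H.l_ne_zero]
  rw [← h, smul_mul_assoc, H.mul_g_mul_gInv]

end Inverse

section AdjacentRelations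

include H

theorem g_mul_g_mul_e_eq (h : adj i j) : g i * g j * e i = e j * (g i * g j) := by
  have hc : g i * g j * g i = g j * (g i * g j) := by rw [H.braid h, mul_assoc]
  have hc2 : g i * g j * (g i * g i) = g j * g j * (g i * g j) := by
    rw [← mul_assoc, hc, mul_assoc, hc, mul_assoc]
  rw [H.e_eq i, H.e_eq j, mul_smul_comm, smul_mul_assoc, mul_sub, sub_mul, mul_add, add_mul,
    hc2, mul_smul_comm, smul_mul_assoc, hc, mul_one, one_mul]

theorem e_mul_e_mul_g_mul_g (h : adj i j) : e i * e j * g i * g j = e i := by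
  calc e i * e j * g i * g j = e i * (g i * g j * e i) := by
        rw [H.g_mul_g_mul_e_eq h]; simp only [mul_assoc]
    _ = e i * g i * g j * e i := by simp only [mul_assoc]
    _ = e i := by
        rw [H.e_mul_g, smul_mul_assoc, smul_mul_assoc, H.ege h, inv_smul_smul₀ H.l_ne_zero]

theorem g_mul_g_mul_e_mul_e (h : adj i j) : g j * (g i * (e j * e i)) = e i := by
  calc g j * (g i * (e j * e i)) = g j * g i * e j * e i := by simp only [mul_assoc]
    _ = e i * g j * (g i * e i) := by
        rw [H.g_mul_g_mul_e_eq (H.symm h)]; simp only [mul_assoc]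
    _ = e i := by
        rw [H.ge, mul_smul_comm, H.ege h, inv_smul_smul₀ H.l_ne_zero]

theorem g_mul_e_mul_e (h : adj i j) : g i * e j * e i = gInv m g e j * e i := by
  nth_rw 2 [← H.g_mul_g_mul_e_mul_e h]
  rw [H.gInv_mul_g_assoc, mul_assoc]

theorem e_mul_e_mul_g (h : adj i j) : e i * e j * g i = e i * gInv m g e j := by
  nth_rw 2 [← H.e_mul_e_mul_g_mul_g h]
  rw [H.mul_g_mul_gInv]

theorem e_mul_gInv_mul_e_eq_sub (h : adj i j) :
    e i * gInv m g e j * e i = (l + m * x) • e i - m • (e i * e j * e i) := by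
  simp only [gInv, mul_sub, mul_add, sub_mul, add_mul, mul_smul_comm, smul_mul_assoc, mul_one,
    H.ege h, H.e_mul_e]
  module

theorem e_mul_e_mul_e (h : adj i j) : e i * e j * e i = e i := by
  have h1 : e i * e j * e i = l • (e i * gInv m g e j * e i) := by
    rw [← H.e_mul_e_mul_g h, mul_assoc _ (g i), H.ge, mul_smul_comm, smul_inv_smul₀ H.l_ne_zero]
  rw [H.e_mul_gInv_mul_e_eq_sub h] at h1
  have h2 : (1 + l * m) • (e i * e j * e i) = (1 + l * m) • e i := by
    have hc : 1 + l * m = l * (l + m * x) := by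
      have := mul_inv_cancel₀ H.l_ne_zero
      linear_combination l * H.m_mul - this
    calc (1 + l * m) • (e i * e j * e i) = e i * e j * e i + (l * m) • (e i * e j * e i) := by
          module
      _ = (l * (l + m * x)) • e i := by nth_rw 1 [h1]; module
      _ = (1 + l * m) • e i := by rw [hc]
  exact smul_right_injective A H.one_add_ne_zero h2

theorem e_mul_gInv_mul_e (h : adj i j) : e i * gInv m g e j * e i = l⁻¹ • e i := by
  rw [H.e_mul_gInv_mul_e_eq_sub h, H.e_mul_e_mul_e h, ← sub_smul]
  congr 1
  linear_combination -H.m_mul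

theorem e_mul_g_mul_g (h : adj i j) : e i * g j * g i = e i * e j := by
  have hj : e j = gInv m g e i * (gInv m g e j * (e i * (g j * g i))) := by
    rw [← H.g_mul_g_mul_e_eq (H.symm h), mul_assoc, H.gInv_mul_g_assoc, H.gInv_mul_g_assoc]
  rw [hj, ← mul_assoc, H.e_mul_gInv, smul_mul_assoc, ← mul_assoc, ← mul_assoc,
    H.e_mul_gInv_mul_e h, smul_mul_assoc, smul_inv_smul₀ H.l_ne_zero, mul_assoc]

theorem g_mul_g_mul_e (h : adj i j) : g i * g j * e i = e j * e i := by
  rw [H.g_mul_g_mul_e_eq h, ← mul_assoc, H.e_mul_g_mul_g (H.symm h)]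

theorem g_mul_e_mul_g (h : adj i j) :
    g i * e j * g i = gInv m g e j * e i * gInv m g e j := by
  have : g j * (g i * e j * g i) * g j = e i := by
    rw [← H.e_mul_e_mul_g_mul_g h, ← H.g_mul_g_mul_e (H.symm h)]
    simp only [mul_assoc]
  rw [← this]
  simp only [mul_assoc, H.gInv_mul_g_assoc, H.g_mul_gInv, mul_one]

end AdjacentRelations

/-- The span of the two generators attached to a node. -/
def nodeSpan (K : Type*) {A ι : Type*} [Field K] [Ring A] [Algebra K A] (g e : ι → A) (i : ι) :
    Submodule K A :=
  Submodule.span K {g i, e i}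

/-- The span of the unit and all generators. -/
def genSpan (K : Type*) {A ι : Type*} [Field K] [Ring A] [Algebra K A] (g e : ι → A) :
    Submodule K A :=
  1 ⊔ ⨆ i, nodeSpan K g e i

/-- The span of the products of generators whose sequence of nodes is a given word. -/
def wordSpan (K : Type*) {A ι : Type*} [Field K] [Ring A] [Algebra K A] (g e : ι → A)
    (ω : List ι) : Submodule K A :=
  (ω.map (nodeSpan K g e)).prod

section Span

omit H

theorem g_mem_nodeSpan (i : ι) : g i ∈ nodeSpan K g e i := Submodule.subset_span (by simp)

theorem e_mem_nodeSpan (i : ι) : e i ∈ nodeSpan K g e i := Submodule.subset_span (by simp)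

theorem nodeSpan_le_genSpan (i : ι) : nodeSpan K g e i ≤ genSpan K g e :=
  le_sup_of_le_right (le_iSup _ i)

theorem one_le_genSpan : 1 ≤ genSpan K g e := le_sup_left

theorem one_mem_genSpan : (1 : A) ∈ genSpan K g e := Submodule.one_le.mp one_le_genSpan

theorem g_mem_genSpan (i : ι) : g i ∈ genSpan K g e := nodeSpan_le_genSpan i (g_mem_nodeSpan i)

theorem e_mem_genSpan (i : ι) : e i ∈ genSpan K g e := nodeSpan_le_genSpan i (e_mem_nodeSpan i)

theorem gInv_mem_genSpan (i : ι) : gInv m g e i ∈ genSpan K g e :=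
  sub_mem (add_mem (g_mem_genSpan i) (Submodule.smul_mem _ _ one_mem_genSpan))
    (Submodule.smul_mem _ _ (e_mem_genSpan i))

theorem genSpan_pow_mono {a b : ℕ} (h : a ≤ b) : genSpan K g e ^ a ≤ genSpan K g e ^ b :=
  pow_le_pow_right₀ one_le_genSpan h

theorem wordSpan_cons (i : ι) (ω : List ι) :
    wordSpan K g e (i :: ω) = nodeSpan K g e i * wordSpan K g e ω := by
  simp [wordSpan]

theorem wordSpan_append (ω ω' : List ι) :
    wordSpan K g e (ω ++ ω') = wordSpan K g e ω * wordSpan K g e ω' := by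
  simp [wordSpan]

theorem wordSpan_le_pow (ω : List ι) : wordSpan K g e ω ≤ genSpan K g e ^ ω.length := by
  induction ω with
  | nil => simp [wordSpan]
  | cons i ω ih =>
    rw [wordSpan_cons, List.length_cons, pow_succ']
    exact mul_le_mul' (nodeSpan_le_genSpan i) ih

end Span

section Reduction

include H

theorem nodeSpan_mul_self_le (i : ι) :
    nodeSpan K g e i * nodeSpan K g e i ≤ genSpan K g e := by
  rw [nodeSpan, Submodule.span_mul_span, Submodule.span_le]
  have he : ∀ c : K, c • e i ∈ genSpan K g e := fun c ↦ Submodule.smul_mem _ c (e_mem_genSpan i)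
  rintro _ ⟨a, (rfl | rfl), b, (rfl | rfl), rfl⟩ <;> simp only [SetLike.mem_coe]
  · rw [H.g_mul_g]
    exact add_mem (sub_mem one_mem_genSpan (Submodule.smul_mem _ _ (g_mem_genSpan i))) (he _)
  · rw [H.ge]; exact he _
  · rw [H.e_mul_g]; exact he _
  · rw [H.e_mul_e]; exact he _

theorem nodeSpan_mul_comm_le (hne : i ≠ j) (h : ¬ adj i j) :
    nodeSpan K g e i * nodeSpan K g e j ≤ nodeSpan K g e j * nodeSpan K g e i := by
  have hgg : Commute (g i) (g j) := H.comm hne h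
  rw [nodeSpan, nodeSpan, Submodule.span_mul_span, Submodule.span_le]
  have hge := H.commute_e hgg
  have heg := (H.commute_e hgg.symm).symm
  have hee := H.commute_e heg
  rintro _ ⟨a, (rfl | rfl), b, (rfl | rfl), rfl⟩ <;> simp only [SetLike.mem_coe]
  · rw [hgg.eq]; exact Submodule.mul_mem_mul (g_mem_nodeSpan j) (g_mem_nodeSpan i)
  · rw [hge.eq]; exact Submodule.mul_mem_mul (e_mem_nodeSpan j) (g_mem_nodeSpan i)
  · rw [heg.eq]; exact Submodule.mul_mem_mul (g_mem_nodeSpan j) (e_mem_nodeSpan i)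
  · rw [hee.eq]; exact Submodule.mul_mem_mul (e_mem_nodeSpan j) (e_mem_nodeSpan i)

open scoped Pointwise in
theorem nodeSpan_braid_le (h : adj i j) :
    nodeSpan K g e i * nodeSpan K g e j * nodeSpan K g e i ≤
      nodeSpan K g e j * nodeSpan K g e i * nodeSpan K g e j ⊔ genSpan K g e ^ 2 := by
  have hmul : ∀ {a b : A}, a ∈ genSpan K g e → b ∈ genSpan K g e →
      a * b ∈ nodeSpan K g e j * nodeSpan K g e i * nodeSpan K g e j ⊔ genSpan K g e ^ 2 :=
    fun ha hb ↦ Submodule.mem_sup_right (pow_two (genSpan K g e) ▸ Submodule.mul_mem_mul ha hb)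
  have he : e i ∈ nodeSpan K g e j * nodeSpan K g e i * nodeSpan K g e j ⊔ genSpan K g e ^ 2 := by
    simpa using hmul (e_mem_genSpan i) one_mem_genSpan
  have he' : e j ∈ nodeSpan K g e j * nodeSpan K g e i * nodeSpan K g e j ⊔ genSpan K g e ^ 2 := by
    simpa using hmul (e_mem_genSpan j) one_mem_genSpan
  have hg := @g_mem_genSpan K A ι _ _ _ g e
  have hE := @e_mem_genSpan K A ι _ _ _ g e
  have hI := @gInv_mem_genSpan K A ι _ _ _ m g e
  have hspan : nodeSpan K g e i * nodeSpan K g e j * nodeSpan K g e i =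
      Submodule.span K (({g i, e i} : Set A) * {g j, e j} * {g i, e i}) := by
    simp only [nodeSpan, Submodule.span_mul_span]
  rw [hspan, Submodule.span_le]
  rintro _ ⟨_, ⟨a, (rfl | rfl), b, (rfl | rfl), rfl⟩, c, (rfl | rfl), rfl⟩ <;>
    simp only [SetLike.mem_coe]
  · rw [H.braid h]
    exact Submodule.mem_sup_left (Submodule.mul_mem_mul (Submodule.mul_mem_mul
      (g_mem_nodeSpan j) (g_mem_nodeSpan i)) (g_mem_nodeSpan j))
  · rw [H.g_mul_g_mul_e h]; exact hmul (hE j) (hE i)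
  · have hexp : g i * e j * g i = g j * e i * g j + m • (g j * e i) - m • (g j * e i * e j) +
        m • (e i * gInv m g e j) - m • (e j * e i * g j) - (m * m) • (e j * e i) +
        (m * m) • (e j * e i * e j) := by
      rw [H.g_mul_e_mul_g h]
      simp only [gInv, mul_sub, mul_add, sub_mul, add_mul, mul_smul_comm, smul_mul_assoc, mul_one,
        one_mul]
      module
    rw [hexp, H.g_mul_e_mul_e (H.symm h), H.e_mul_e_mul_g (H.symm h), H.e_mul_e_mul_e (H.symm h)]
    have hs : ∀ (c : K) {a : A},
        a ∈ nodeSpan K g e j * nodeSpan K g e i * nodeSpan K g e j ⊔ genSpan K g e ^ 2 →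
        c • a ∈ nodeSpan K g e j * nodeSpan K g e i * nodeSpan K g e j ⊔ genSpan K g e ^ 2 :=
      fun c _ ↦ Submodule.smul_mem _ c
    refine add_mem (sub_mem (sub_mem (add_mem (sub_mem (add_mem ?_ ?_) ?_) ?_) ?_) ?_) (hs _ he')
    · exact Submodule.mem_sup_left (Submodule.mul_mem_mul (Submodule.mul_mem_mul
        (g_mem_nodeSpan j) (e_mem_nodeSpan i)) (g_mem_nodeSpan j))
    · exact hs _ (hmul (hg j) (hE i))
    · exact hs _ (hmul (hI i) (hE j))
    · exact hs _ (hmul (hE i) (hI j))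
    · exact hs _ (hmul (hE j) (hI i))
    · exact hs _ (hmul (hE j) (hE i))
  · rw [H.g_mul_e_mul_e h]; exact hmul (hI j) (hE i)
  · rw [H.e_mul_g_mul_g h]; exact hmul (hE i) (hE j)
  · rw [H.ege h]; exact Submodule.smul_mem _ _ he
  · rw [H.e_mul_e_mul_g h]; exact hmul (hE i) (hI j)
  · rw [H.e_mul_e_mul_e h]; exact he

theorem wordSpan_le_of_braidEquiv {ω ω' : List ι} (h : CoxeterMatrix.BraidEquiv adj ω ω') {k : ℕ}
    (hk : ω.length ≤ k + 1) :
    wordSpan K g e ω ≤ wordSpan K g e ω' ⊔ genSpan K g e ^ k := by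
  induction h generalizing k with
  | refl ω => exact le_sup_left
  | trans h₁ _ ih₁ ih₂ =>
    exact (ih₁ hk).trans (sup_le (ih₂ (h₁.length_eq ▸ hk)) le_sup_right)
  | @cons i ω₁ ω₂ h ih =>
    rw [wordSpan_cons, wordSpan_cons]
    cases k with
    | zero =>
      have h₁ : ω₁ = [] := by simpa using hk
      have h₂ : ω₂ = [] := by simpa [h₁] using h.length_eq.symm
      rw [h₁, h₂]
      exact le_sup_left
    | succ k =>
      calc nodeSpan K g e i * wordSpan K g e ω₁
          ≤ nodeSpan K g e i * (wordSpan K g e ω₂ ⊔ genSpan K g e ^ k) :=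
            mul_le_mul_right (ih (by simpa using hk)) _
        _ ≤ nodeSpan K g e i * wordSpan K g e ω₂ ⊔ genSpan K g e ^ (k + 1) := by
            rw [Submodule.mul_sup, pow_succ']
            exact sup_le_sup_left (mul_le_mul' (nodeSpan_le_genSpan i) le_rfl) _
  | comm i j ω hne hadj =>
    refine le_sup_of_le_left ?_
    simp only [wordSpan_cons, ← mul_assoc]
    exact mul_le_mul' (H.nodeSpan_mul_comm_le hne hadj) le_rfl
  | braid i j ω hadj =>
    simp only [wordSpan_cons, ← mul_assoc]
    refine (mul_le_mul' (H.nodeSpan_braid_le hadj) le_rfl).trans ?_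
    rw [Submodule.sup_mul]
    refine sup_le_sup_left ((mul_le_mul' le_rfl (wordSpan_le_pow ω)).trans ?_) _
    rw [← pow_add]
    exact genSpan_pow_mono (by simp at hk; lia)

theorem wordSpan_append_cons_cons_le (u v : List ι) (i : ι) :
    wordSpan K g e (u ++ i :: i :: v) ≤ genSpan K g e ^ (u.length + v.length + 1) := by
  rw [wordSpan_append, wordSpan_cons, wordSpan_cons, ← mul_assoc (nodeSpan K g e i),
    add_assoc, add_comm v.length, pow_add, pow_add, pow_one]
  exact mul_le_mul' (wordSpan_le_pow u)
    (mul_le_mul' (H.nodeSpan_mul_self_le i) (wordSpan_le_pow v))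

omit H in
theorem genSpan_pow_le_iSup (k : ℕ) :
    genSpan K g e ^ k ≤ ⨆ (ω : List ι) (_ : ω.length ≤ k), wordSpan K g e ω := by
  induction k with
  | zero => exact le_iSup₂_of_le [] le_rfl (by simp [wordSpan])
  | succ k ih =>
    rw [pow_succ']
    refine (mul_le_mul' le_rfl ih).trans ?_
    rw [genSpan, Submodule.sup_mul, one_mul]
    simp only [Submodule.iSup_mul, Submodule.mul_iSup]
    refine sup_le (iSup₂_le fun ω (hω : ω.length ≤ k) ↦ le_iSup₂_of_le ω (by lia) le_rfl)
      (iSup₂_le fun ω hω ↦ iSup_le fun i ↦ le_iSup₂_of_le (i :: ω) (by simpa using hω) ?_)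
    rw [wordSpan_cons]

/-- Products of more generators than the maximal length in the Coxeter group are combinations of
products of fewer generators. -/
theorem genSpan_pow_succ_le {W : Type*} [Group W] {M : CoxeterMatrix ι} (cs : CoxeterSystem M W)
    (hM : M.IsSimplyLaced) (hadj : ∀ i j, adj i j ↔ i ≠ j ∧ M i j = 3) {k : ℕ}
    (hk : ∀ w, cs.length w ≤ k) : genSpan K g e ^ (k + 1) ≤ genSpan K g e ^ k := by
  refine (genSpan_pow_le_iSup (k + 1)).trans (iSup₂_le fun ω hω ↦ ?_)
  rcases hω.lt_or_eq with hlt | heq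
  · exact (wordSpan_le_pow ω).trans (genSpan_pow_mono (by lia))
  · have hred : ¬ cs.IsReduced ω := fun h ↦ by
      have := hk (cs.wordProd ω)
      rw [h.eq] at this
      lia
    obtain ⟨u, i, v, h⟩ := cs.exists_braidEquiv_of_not_isReduced hM hadj hred
    refine (H.wordSpan_le_of_braidEquiv h hω).trans
      (sup_le ((H.wordSpan_append_cons_cons_le u v i).trans (genSpan_pow_mono ?_)) le_rfl)
    have := h.length_eq
    simp at this
    lia

theorem genSpan_pow_le {W : Type*} [Group W] {M : CoxeterMatrix ι} (cs : CoxeterSystem M W)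
    (hM : M.IsSimplyLaced) (hadj : ∀ i j, adj i j ↔ i ≠ j ∧ M i j = 3) {N : ℕ}
    (hN : ∀ w, cs.length w ≤ N) (k : ℕ) : genSpan K g e ^ k ≤ genSpan K g e ^ N := by
  rcases le_total k N with h | h
  · exact genSpan_pow_mono h
  · induction k, h using Nat.le_induction with
    | base => exact le_rfl
    | succ k hk ih =>
      exact (H.genSpan_pow_succ_le cs hM hadj fun w ↦ (hN w).trans hk).trans ih

end Reduction

theorem fg_genSpan [Finite ι] : (genSpan K g e).FG := by
  rw [genSpan, Submodule.one_eq_span]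
  exact (Submodule.fg_span_singleton 1).sup
    (Submodule.fg_iSup _ fun _ ↦ Submodule.fg_span (Set.toFinite _))

theorem genSpan_pow_le_span_prod {S : Set A} (hg : ∀ i, g i ∈ S) (he : ∀ i, e i ∈ S) (k : ℕ) :
    genSpan K g e ^ k ≤
      Submodule.span K {p | ∃ v : List A, (∀ a ∈ v, a ∈ S) ∧ v.length ≤ k ∧ p = v.prod} := by
  refine (genSpan_pow_le_iSup k).trans (iSup₂_le fun ω hω ↦ ?_)
  suffices h : wordSpan K g e ω ≤ Submodule.span K
      {p | ∃ v : List A, (∀ a ∈ v, a ∈ S) ∧ v.length = ω.length ∧ p = v.prod} from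
    h.trans (Submodule.span_mono fun p ⟨v, hv, hl, hp⟩ ↦ ⟨v, hv, hl ▸ hω, hp⟩)
  clear hω
  induction ω with
  | nil =>
    rw [wordSpan, List.map_nil, List.prod_nil, Submodule.one_le]
    exact Submodule.subset_span ⟨[], by simp⟩
  | cons i ω ih =>
    rw [wordSpan_cons]
    refine (mul_le_mul' le_rfl ih).trans ?_
    rw [nodeSpan, Submodule.span_mul_span]
    refine Submodule.span_mono ?_
    rintro _ ⟨a, ha, _, ⟨v, hv, hl, rfl⟩, rfl⟩
    have haS : a ∈ S := by
      rcases ha with rfl | rfl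
      exacts [hg i, he i]
    exact ⟨a :: v, List.forall_mem_cons.mpr ⟨haS, hv⟩, by simp [hl], by simp⟩

theorem prod_mem_genSpan_pow {v : List A} (hv : ∀ a ∈ v, a ∈ genSpan K g e) :
    v.prod ∈ genSpan K g e ^ v.length := by
  induction v with
  | nil => simpa using Submodule.one_le.mp (le_refl (1 : Submodule K A))
  | cons a v ih =>
    rw [List.forall_mem_cons] at hv
    rw [List.prod_cons, List.length_cons, pow_succ']
    exact Submodule.mul_mem_mul hv.1 (ih hv.2)

end IsBMWFamily

theorem one_sub_xP_ne_zero : 1 - xP ≠ 0 := fun h ↦ by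
  have h' : algebraMap (MvPolynomial (Fin 2) ℚ) BMWField (1 - MvPolynomial.X 1) = 0 := by
    simpa [xP] using h
  rw [FaithfulSMul.algebraMap_eq_zero_iff] at h'
  simpa using congrArg (MvPolynomial.eval 0) h'

theorem lP_ne_zero : lP ≠ 0 := fun h ↦ by
  rw [lP, FaithfulSMul.algebraMap_eq_zero_iff] at h
  exact MvPolynomial.X_ne_zero 0 h

theorem mP_mul_one_sub_xP : mP * (1 - xP) = lP - lP⁻¹ :=
  div_mul_cancel₀ _ one_sub_xP_ne_zero

theorem mP_ne_zero : mP ≠ 0 := fun h ↦ by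
  have h₁ : lP * lP - 1 = 0 := by
    have := mP_mul_one_sub_xP
    have hl := lP_ne_zero
    rw [h, zero_mul] at this
    field_simp at this
    linear_combination -this
  have h₂ : algebraMap (MvPolynomial (Fin 2) ℚ) BMWField
      (MvPolynomial.X 0 * MvPolynomial.X 0 - 1) = 0 := by
    simpa [lP] using h₁
  rw [FaithfulSMul.algebraMap_eq_zero_iff] at h₂
  simpa using congrArg (MvPolynomial.eval 0) h₂

theorem one_add_lP_mul_mP_ne_zero : 1 + lP * mP ≠ 0 := fun h ↦ by
  have h₁ : lP * lP - xP = 0 := by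
    have := mP_mul_one_sub_xP
    have hl := mul_inv_cancel₀ lP_ne_zero
    linear_combination (1 - xP) * h - lP * this + hl
  have h₂ : algebraMap (MvPolynomial (Fin 2) ℚ) BMWField
      (MvPolynomial.X 0 * MvPolynomial.X 0 - MvPolynomial.X 1) = 0 := by
    simpa [lP, xP] using h₁
  rw [FaithfulSMul.algebraMap_eq_zero_iff] at h₂
  simpa using congrArg (MvPolynomial.eval ![0, 1]) h₂

theorem isBMWFamily_gg_ee {n : ℕ} {adj : Fin n → Fin n → Prop}
    (symm : ∀ i j, adj i j → adj j i) :
    IsBMWFamily lP xP mP adj (gg n adj) (ee n adj) where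
  l_ne_zero := lP_ne_zero
  m_ne_zero := mP_ne_zero
  one_add_ne_zero := one_add_lP_mul_mP_ne_zero
  m_mul := mP_mul_one_sub_xP
  symm := symm _ _
  comm hne h := by
    simpa [gg] using RingQuot.mkAlgHom_rel BMWField (BMWRel.comm _ _ hne h)
  braid h := by
    simpa [gg] using RingQuot.mkAlgHom_rel BMWField (BMWRel.braid _ _ h)
  defE i := by
    simpa [gg, ee] using RingQuot.mkAlgHom_rel BMWField (BMWRel.defE (adj := adj) i)
  ge i := by
    simpa [gg, ee] using RingQuot.mkAlgHom_rel BMWField (BMWRel.ge (adj := adj) i)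
  ege h := by
    simpa [gg, ee] using RingQuot.mkAlgHom_rel BMWField (BMWRel.ege _ _ h)

namespace IsBMWFamily

theorem ringInverse_g {K A ι : Type*} [Field K] [Ring A] [Algebra K A] {l x m : K}
    {adj : ι → ι → Prop} {g e : ι → A} (H : IsBMWFamily l x m adj g e) (i : ι) :
    Ring.inverse (g i) = gInv m g e i :=
  Ring.inverse_unit ⟨g i, gInv m g e i, H.g_mul_gInv i, H.gInv_mul_g i⟩

end IsBMWFamily

open IsBMWFamily in
theorem mem_genSpan_of_mem_BMWGens {n : ℕ} {adj : Fin n → Fin n → Prop}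
    (symm : ∀ i j, adj i j → adj j i) {a : BMW n adj} (ha : a ∈ BMWGens n adj) :
    a ∈ genSpan BMWField (gg n adj) (ee n adj) := by
  obtain ⟨i, rfl | rfl | rfl⟩ := ha
  · exact g_mem_genSpan i
  · exact e_mem_genSpan i
  · rw [(isBMWFamily_gg_ee symm).ringInverse_g]
    exact gInv_mem_genSpan i

open IsBMWFamily in
theorem top_le_genSpan_pow {n : ℕ} {adj : Fin n → Fin n → Prop} {N : ℕ}
    (hN : ∀ k, genSpan BMWField (gg n adj) (ee n adj) ^ k ≤
      genSpan BMWField (gg n adj) (ee n adj) ^ N) :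
    ⊤ ≤ genSpan BMWField (gg n adj) (ee n adj) ^ N := by
  have hgen : genSpan BMWField (gg n adj) (ee n adj) ≤
      genSpan BMWField (gg n adj) (ee n adj) ^ N := by simpa using hN 1
  intro a _
  obtain ⟨b, rfl⟩ := RingQuot.mkAlgHom_surjective BMWField (BMWRel n adj) a
  induction b using FreeAlgebra.induction with
  | grade0 c =>
    rw [AlgHom.commutes, Algebra.algebraMap_eq_smul_one]
    exact Submodule.smul_mem _ c (hgen one_mem_genSpan)
  | grade1 s =>
    cases s with
    | inl i => exact hgen (g_mem_genSpan i)
    | inr i => exact hgen (e_mem_genSpan i)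
  | mul a b ha hb =>
    rw [map_mul]
    exact hN (N + N) (pow_add (genSpan BMWField (gg n adj) (ee n adj)) N N ▸
      Submodule.mul_mem_mul (ha trivial) (hb trivial))
  | add a b ha hb =>
    rw [map_add]
    exact add_mem (ha trivial) (hb trivial)

/-- If `M` is a spherical simply laced Coxeter diagram whose longest element has
length `N = |Φ⁺|`, then in the BMW algebra every product of letters `g_i, g_i⁻¹, e_i`
of length `> N` lies in the span of strictly shorter such products; consequently the
BMW algebra is spanned by products of length at most `N` and is finite dimensional. -/
theorem bmw_finite_dimensional (n : ℕ) (M : CoxeterMatrix (Fin n))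
    (hM : ∀ i j : Fin n, i ≠ j → M i j = 2 ∨ M i j = 3)
    (adj : Fin n → Fin n → Prop)
    (hadj : ∀ i j, adj i j ↔ (i ≠ j ∧ M i j = 3))
    (hfin : Finite M.Group)
    (N : ℕ)
    (hNbound : ∀ w : M.Group, M.toCoxeterSystem.length w ≤ N)
    (hNattained : ∃ w : M.Group, M.toCoxeterSystem.length w = N) :
    (∀ w : List (BMW n adj), (∀ a ∈ w, a ∈ BMWGens n adj) → N < w.length →
      w.prod ∈ Submodule.span BMWField
        {p : BMW n adj | ∃ v : List (BMW n adj),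
          (∀ a ∈ v, a ∈ BMWGens n adj) ∧ v.length < w.length ∧ p = v.prod}) ∧
    (⊤ : Submodule BMWField (BMW n adj)) ≤ Submodule.span BMWField
        {p : BMW n adj | ∃ v : List (BMW n adj),
          (∀ a ∈ v, a ∈ BMWGens n adj) ∧ v.length ≤ N ∧ p = v.prod} ∧
    FiniteDimensional BMWField (BMW n adj) := by
  have symm : ∀ i j, adj i j → adj j i := fun i j h ↦ by
    rw [hadj] at h ⊢
    exact ⟨h.1.symm, M.symmetric i j ▸ h.2⟩
  have H := isBMWFamily_gg_ee symm
  have hspan := IsBMWFamily.genSpan_pow_le_span_prod (K := BMWField) (S := BMWGens n adj)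
    (fun i ↦ ⟨i, .inl rfl⟩) (fun i ↦ ⟨i, .inr (.inl rfl)⟩)
  have htop := top_le_genSpan_pow (H.genSpan_pow_le M.toCoxeterSystem hM hadj hNbound)
  refine ⟨fun w hw hlen ↦ ?_, htop.trans (hspan N), ?_⟩
  · obtain ⟨k, hk⟩ : ∃ k, w.length = k + 1 := Nat.exists_eq_add_one.mpr (by lia)
    have hmem := IsBMWFamily.prod_mem_genSpan_pow
      fun a ha ↦ mem_genSpan_of_mem_BMWGens symm (hw a ha)
    rw [hk] at hmem
    refine Submodule.span_mono ?_ (hspan k (H.genSpan_pow_succ_le M.toCoxeterSystem hM hadj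
      (fun u ↦ (hNbound u).trans (by lia)) hmem))
    rintro p ⟨v, hv, hl, hp⟩
    exact ⟨v, hv, by lia, hp⟩
  · rw [FiniteDimensional, Module.finite_def, ← top_le_iff.mp htop]
    exact IsBMWFamily.fg_genSpan.pow N
end
end

section
/- The BMW algebra of type A_2 has dimension 15 over Q(l,x), with basis the monomials 1; g_1, g_2, e_1, e_2; g_1 g_2, g_1 e_2, g_2 g_1, g_2 e_1, e_1 g_2, e_1 e_2, e_2 g_1, e_2 e_1; g_1 g_2 g_1, g_1 e_2 g_1. -/
noncomputable section

/-- The adjacency relation of the diagram `A₂` (the two nodes are adjacent). -/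
def adjA2 : Fin 2 → Fin 2 → Prop := fun i j => i ≠ j

/-- The fifteen monomials `1; g₁, g₂, e₁, e₂; g₁g₂, g₁e₂, g₂g₁, g₂e₁, e₁g₂, e₁e₂,
e₂g₁, e₂e₁; g₁g₂g₁, g₁e₂g₁` in the BMW algebra of type `A₂`. -/
def a2Basis : Fin 15 → BMW 2 adjA2 :=
  ![1,
    gg 2 adjA2 0, gg 2 adjA2 1, ee 2 adjA2 0, ee 2 adjA2 1,
    gg 2 adjA2 0 * gg 2 adjA2 1, gg 2 adjA2 0 * ee 2 adjA2 1,
    gg 2 adjA2 1 * gg 2 adjA2 0, gg 2 adjA2 1 * ee 2 adjA2 0,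
    ee 2 adjA2 0 * gg 2 adjA2 1, ee 2 adjA2 0 * ee 2 adjA2 1,
    ee 2 adjA2 1 * gg 2 adjA2 0, ee 2 adjA2 1 * ee 2 adjA2 0,
    gg 2 adjA2 0 * gg 2 adjA2 1 * gg 2 adjA2 0,
    gg 2 adjA2 0 * ee 2 adjA2 1 * gg 2 adjA2 0]

namespace BMWA2

section Relations

variable {K A : Type*} [Field K] [Ring A] [Algebra K A]

/-- The defining relations of the BMW algebra of type `A₂`, for elements of an arbitrary algebra. -/
structure Relations (l m : K) (g₁ g₂ e₁ e₂ : A) : Prop where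
  braid : g₁ * g₂ * g₁ = g₂ * g₁ * g₂
  smul_e₁ : m • e₁ = l • (g₁ * g₁ + m • g₁ - 1)
  smul_e₂ : m • e₂ = l • (g₂ * g₂ + m • g₂ - 1)
  ge₁ : g₁ * e₁ = l⁻¹ • e₁
  ge₂ : g₂ * e₂ = l⁻¹ • e₂
  ege₁ : e₁ * g₂ * e₁ = l • e₁
  ege₂ : e₂ * g₁ * e₂ = l • e₂

/-- The conditions on the parameters under which the multiplication table is derived. -/
structure Parameters (l m x : K) : Prop where
  l_ne_zero : l ≠ 0
  m_ne_zero : m ≠ 0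
  add_inv_ne_zero : m + l⁻¹ ≠ 0
  mul_one_sub : m * (1 - x) = l - l⁻¹

namespace Relations

variable {l m x : K} {g₁ g₂ e₁ e₂ : A}

theorem symm (h : Relations l m g₁ g₂ e₁ e₂) : Relations l m g₂ g₁ e₂ e₁ :=
  ⟨h.braid.symm, h.smul_e₂, h.smul_e₁, h.ge₂, h.ge₁, h.ege₂, h.ege₁⟩

theorem g_mul_g (h : Relations l m g₁ g₂ e₁ e₂) (p : Parameters l m x) :
    g₁ * g₁ = 1 - m • g₁ + (m * l⁻¹) • e₁ := by
  have hl := p.l_ne_zero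
  have : g₁ * g₁ + m • g₁ - 1 = l⁻¹ • m • e₁ := by
    rw [h.smul_e₁, smul_smul, inv_mul_cancel₀ hl, one_smul]
  rw [mul_comm m, mul_smul, ← this]
  abel

theorem e_eq (h : Relations l m g₁ g₂ e₁ e₂) (p : Parameters l m x) :
    e₁ = (m⁻¹ * l) • (g₁ * g₁ + m • g₁ - 1) := by
  rw [mul_smul, ← h.smul_e₁, smul_smul, inv_mul_cancel₀ p.m_ne_zero, one_smul]

theorem e_mem (h : Relations l m g₁ g₂ e₁ e₂) (p : Parameters l m x) {S : Subalgebra K A}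
    (hg : g₁ ∈ S) : e₁ ∈ S := by
  rw [h.e_eq p]
  exact S.smul_mem (sub_mem (add_mem (mul_mem hg hg) (S.smul_mem hg _)) (one_mem S)) _

theorem eg (h : Relations l m g₁ g₂ e₁ e₂) (p : Parameters l m x) :
    e₁ * g₁ = l⁻¹ • e₁ := by
  rw [← h.ge₁, h.e_eq p]
  simp only [smul_mul_assoc, mul_smul_comm, mul_sub, sub_mul, mul_add, add_mul, mul_assoc,
    mul_one, one_mul]

theorem e_mul_e (h : Relations l m g₁ g₂ e₁ e₂) (p : Parameters l m x) :
    e₁ * e₁ = x • e₁ := by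
  have hl := p.l_ne_zero
  have hm := p.m_ne_zero
  have hx : x = (m⁻¹ * l) * (l⁻¹ * l⁻¹ + m * l⁻¹ - 1) := by
    have := p.mul_one_sub
    field_simp at this ⊢
    linear_combination -this
  nth_rewrite 1 [h.e_eq p]
  simp only [smul_mul_assoc, sub_mul, add_mul, mul_assoc, one_mul, h.ge₁, mul_smul_comm]
  rw [hx]
  module

/-- Conjugation by `g₁ * g₂` carries `e₁` to `e₂`. -/
theorem gg_mul_e (h : Relations l m g₁ g₂ e₁ e₂) (p : Parameters l m x) :
    g₁ * g₂ * e₁ = e₂ * g₁ * g₂ := by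
  have hb : g₁ * (g₂ * g₁) = g₂ * (g₁ * g₂) := by simpa only [mul_assoc] using h.braid
  have hb' : g₁ * (g₂ * (g₁ * g₁)) = g₂ * (g₂ * (g₁ * g₂)) := by
    calc g₁ * (g₂ * (g₁ * g₁)) = g₁ * (g₂ * g₁) * g₁ := by simp only [mul_assoc]
      _ = g₂ * (g₂ * (g₁ * g₂)) := by rw [hb, mul_assoc, mul_assoc, hb]
  rw [h.e_eq p, h.symm.e_eq p]
  simp only [smul_mul_assoc, mul_smul_comm, mul_sub, sub_mul, mul_add, add_mul, mul_assoc,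
    mul_one, one_mul, hb, hb']

theorem gge_eq (h : Relations l m g₁ g₂ e₁ e₂) (p : Parameters l m x) :
    g₁ * g₂ * e₁ = e₂ * e₁ := by
  have key : l • (g₁ * g₂ * e₁) =
      (l⁻¹ + m) • (e₂ * e₁) - (m * x) • (g₁ * g₂ * e₁) := by
    calc l • (g₁ * g₂ * e₁) = g₁ * g₂ * e₁ * g₂ * e₁ := by
          rw [← mul_smul_comm, ← h.ege₁]; simp only [mul_assoc]
      _ = e₂ * g₁ * (g₂ * g₂) * e₁ := by rw [h.gg_mul_e p]; simp only [mul_assoc]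
      _ = e₂ * (g₁ * e₁) - m • (e₂ * g₁ * g₂ * e₁) +
            (m * l⁻¹) • (e₂ * g₁ * e₂ * e₁) := by
          rw [h.symm.g_mul_g p]
          simp only [mul_add, mul_sub, add_mul, sub_mul, mul_one, smul_mul_assoc, mul_smul_comm,
            mul_assoc]
      _ = _ := by
          rw [← h.gg_mul_e p, h.ege₂, h.ge₁, mul_assoc _ e₁ e₁, h.e_mul_e p]
          simp only [smul_mul_assoc, mul_smul_comm, smul_smul]
          rw [mul_assoc m, inv_mul_cancel₀ p.l_ne_zero]
          module
  have hx : m * x = m - l + l⁻¹ := by linear_combination -p.mul_one_sub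
  have : (m + l⁻¹) • (g₁ * g₂ * e₁) = (m + l⁻¹) • (e₂ * e₁) := by
    rw [hx] at key
    linear_combination (norm := module) key
  exact (smul_right_injective A p.add_inv_ne_zero) this

theorem egg (h : Relations l m g₁ g₂ e₁ e₂) (p : Parameters l m x) :
    e₁ * g₂ * g₁ = e₁ * e₂ := by
  rw [← h.symm.gg_mul_e p, h.symm.gge_eq p]

theorem eee (h : Relations l m g₁ g₂ e₁ e₂) (p : Parameters l m x) :
    e₁ * e₂ * e₁ = e₁ := by
  rw [mul_assoc, ← h.gge_eq p, ← mul_assoc, ← mul_assoc, h.eg p, smul_mul_assoc, smul_mul_assoc,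
    h.ege₁, smul_smul, inv_mul_cancel₀ p.l_ne_zero, one_smul]

theorem gee (h : Relations l m g₁ g₂ e₁ e₂) (p : Parameters l m x) :
    g₁ * e₂ * e₁ = g₂ * e₁ - m • (e₂ * e₁) + m • e₁ := by
  rw [mul_assoc, ← h.gge_eq p, mul_assoc g₁ g₂, ← mul_assoc g₁ g₁, h.g_mul_g p]
  simp only [add_mul, sub_mul, one_mul, smul_mul_assoc]
  rw [← mul_assoc e₁, h.ege₁, smul_smul, mul_assoc m, inv_mul_cancel₀ p.l_ne_zero, mul_one]

theorem eeg (h : Relations l m g₁ g₂ e₁ e₂) (p : Parameters l m x) :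
    e₁ * e₂ * g₁ = e₁ * g₂ - m • (e₁ * e₂) + m • e₁ := by
  rw [← h.egg p, mul_assoc _ g₁ g₁, h.g_mul_g p]
  simp only [mul_add, mul_sub, mul_one, mul_smul_comm]
  rw [h.ege₁, smul_smul, mul_assoc m, inv_mul_cancel₀ p.l_ne_zero, mul_one]

theorem inv_mul (h : Relations l m g₁ g₂ e₁ e₂) (p : Parameters l m x) :
    (g₁ + m • 1 - m • e₁) * g₁ = 1 := by
  simp only [add_mul, sub_mul, smul_mul_assoc, one_mul, h.g_mul_g p, h.eg p]
  module

theorem mul_inv (h : Relations l m g₁ g₂ e₁ e₂) (p : Parameters l m x) :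
    g₁ * (g₁ + m • 1 - m • e₁) = 1 := by
  simp only [mul_add, mul_sub, mul_smul_comm, mul_one, h.g_mul_g p, h.ge₁]
  module

theorem geg (h : Relations l m g₁ g₂ e₁ e₂) (p : Parameters l m x) :
    g₂ * e₁ * g₂ = g₁ * e₂ * g₁ + m • (g₁ * e₂) + m • (e₂ * g₁) - m • (g₂ * e₁)
      - m • (e₁ * g₂) + (m * m) • e₂ - (m * m) • e₁ := by
  have h₁ : g₁ * (g₂ * e₁ * g₂) * g₁ = e₂ := by
    rw [← mul_assoc, ← mul_assoc, h.gge_eq p, mul_assoc, mul_assoc, ← mul_assoc e₁, h.egg p,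
      ← mul_assoc, h.symm.eee p]
  have h₂ : g₂ * e₁ * g₂ = (g₁ + m • 1 - m • e₁) * e₂ * (g₁ + m • 1 - m • e₁) := by
    rw [← h₁]
    rw [mul_assoc g₁, ← mul_assoc _ g₁, h.inv_mul p, one_mul, mul_assoc _ g₁, h.mul_inv p, mul_one]
  rw [h₂]
  simp only [mul_add, mul_sub, mul_smul_comm, mul_one, add_mul, sub_mul, smul_mul_assoc, one_mul,
    h.eee p, h.gee p, h.eeg p]
  module

end Relations

/-- The fifteen standard monomials in elements `g₁, g₂, e₁, e₂` of an algebra. -/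
def monomials (g₁ g₂ e₁ e₂ : A) : Fin 15 → A :=
  ![1, g₁, g₂, e₁, e₂, g₁ * g₂, g₁ * e₂, g₂ * g₁, g₂ * e₁, e₁ * g₂, e₁ * e₂, e₂ * g₁, e₂ * e₁,
    g₁ * g₂ * g₁, g₁ * e₂ * g₁]

end Relations

theorem eq_vec {K : Type*} (v : Fin 15 → K) : v =
    ![v 0, v 1, v 2, v 3, v 4, v 5, v 6, v 7, v 8, v 9, v 10, v 11, v 12, v 13, v 14] :=
  (FinVec.etaExpand_eq v).symm

section Table

variable {K : Type*} [Field K]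

/-- Left multiplication by `g₁` in coordinates with respect to the standard monomials. -/
def leftG₁ (l m : K) : Module.End K (Fin 15 → K) where
  toFun v := ![v 1, v 0 - m * v 1, v 5, m * l⁻¹ * v 1 + l⁻¹ * v 3 + m * v 12 + m * l⁻¹ * m * v 14,
    v 6, v 2 - m * v 5, v 4 - m * v 6, v 13, v 12, m * l⁻¹ * v 5 + l⁻¹ * v 9 + m * l⁻¹ * v 14,
    m * l⁻¹ * v 6 + l⁻¹ * v 10 + m * l⁻¹ * v 13 - m * l⁻¹ * m * v 14, v 14, v 8 - m * v 12,
    v 7 - m * v 13, v 11 - m * v 14]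
  map_add' v w := by ext i; fin_cases i <;> simp <;> ring
  map_smul' c v := by ext i; fin_cases i <;> simp <;> ring

theorem leftG₁_vec (l m v0 v1 v2 v3 v4 v5 v6 v7 v8 v9 v10 v11 v12 v13 v14 : K) :
    leftG₁ l m
      ![v0, v1, v2, v3, v4, v5, v6, v7, v8, v9, v10, v11, v12, v13, v14] =
    ![v1, v0 - m * v1, v5, m * l⁻¹ * v1 + l⁻¹ * v3 + m * v12 + m * l⁻¹ * m * v14,
      v6, v2 - m * v5, v4 - m * v6, v13, v12, m * l⁻¹ * v5 + l⁻¹ * v9 + m * l⁻¹ * v14,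
      m * l⁻¹ * v6 + l⁻¹ * v10 + m * l⁻¹ * v13 - m * l⁻¹ * m * v14, v14, v8 - m * v12,
      v7 - m * v13, v11 - m * v14] :=
  rfl

/-- Left multiplication by `g₂` in coordinates with respect to the standard monomials. -/
def leftG₂ (l m : K) : Module.End K (Fin 15 → K) where
  toFun v := ![v 2, v 7, v 0 - m * v 2, v 8 - m * m * v 9 + m * v 14,
    m * l⁻¹ * v 2 + l⁻¹ * v 4 + m * m * v 9 + m * v 10, v 13, m * v 9 + v 10,
    v 1 - m * v 7, v 3 - m * v 8 - m * v 9, v 14 - m * v 9, v 6 - m * v 10 - m * v 14,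
    m * l⁻¹ * v 7 + m * v 9 + l⁻¹ * v 11, m * l⁻¹ * v 8 + l⁻¹ * v 12 + m * l⁻¹ * v 13,
    v 5 - m * v 13, v 9]
  map_add' v w := by ext i; fin_cases i <;> simp <;> ring
  map_smul' c v := by ext i; fin_cases i <;> simp <;> ring

theorem leftG₂_vec (l m v0 v1 v2 v3 v4 v5 v6 v7 v8 v9 v10 v11 v12 v13 v14 : K) :
    leftG₂ l m
      ![v0, v1, v2, v3, v4, v5, v6, v7, v8, v9, v10, v11, v12, v13, v14] =
    ![v2, v7, v0 - m * v2, v8 - m * m * v9 + m * v14,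
      m * l⁻¹ * v2 + l⁻¹ * v4 + m * m * v9 + m * v10, v13, m * v9 + v10,
      v1 - m * v7, v3 - m * v8 - m * v9, v14 - m * v9, v6 - m * v10 - m * v14,
      m * l⁻¹ * v7 + m * v9 + l⁻¹ * v11, m * l⁻¹ * v8 + l⁻¹ * v12 + m * l⁻¹ * v13,
      v5 - m * v13, v9] :=
  rfl

/-- Left multiplication by `e₁` in coordinates with respect to the standard monomials. -/
def leftE₁ (l m x : K) : Module.End K (Fin 15 → K) where
  toFun v := ![0, 0, 0,
    v 0 + l⁻¹ * v 1 + x * v 3 + l * v 8 + m * v 11 + v 12 + m * l⁻¹ * v 14, 0, 0, 0, 0, 0,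
    v 2 + l⁻¹ * v 5 + x * v 9 + v 11 + l⁻¹ * v 14,
    v 4 + l⁻¹ * v 6 + v 7 + x * v 10 - m * v 11 + l⁻¹ * v 13 - m * l⁻¹ * v 14, 0, 0, 0, 0]
  map_add' v w := by ext i; fin_cases i <;> simp <;> ring
  map_smul' c v := by ext i; fin_cases i <;> simp <;> ring

theorem leftE₁_vec (l m x v0 v1 v2 v3 v4 v5 v6 v7 v8 v9 v10 v11 v12 v13 v14 : K) :
    leftE₁ l m x
      ![v0, v1, v2, v3, v4, v5, v6, v7, v8, v9, v10, v11, v12, v13, v14] =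
    ![0, 0, 0,
      v0 + l⁻¹ * v1 + x * v3 + l * v8 + m * v11 + v12 + m * l⁻¹ * v14, 0, 0, 0, 0, 0,
      v2 + l⁻¹ * v5 + x * v9 + v11 + l⁻¹ * v14,
      v4 + l⁻¹ * v6 + v7 + x * v10 - m * v11 + l⁻¹ * v13 - m * l⁻¹ * v14, 0, 0, 0, 0] :=
  rfl

/-- Left multiplication by `e₂` in coordinates with respect to the standard monomials. -/
def leftE₂ (l m x : K) : Module.End K (Fin 15 → K) where
  toFun v := ![0, 0, 0, 0,
    v 0 + l⁻¹ * v 2 + x * v 4 + l * v 6 + m * v 9 + v 10, 0, 0, 0, 0, 0, 0,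
    v 1 + l⁻¹ * v 7 + v 9 + x * v 11 + l * v 14,
    v 3 + v 5 + l⁻¹ * v 8 - m * v 9 + x * v 12 + l⁻¹ * v 13, 0, 0]
  map_add' v w := by ext i; fin_cases i <;> simp <;> ring
  map_smul' c v := by ext i; fin_cases i <;> simp <;> ring

theorem leftE₂_vec (l m x v0 v1 v2 v3 v4 v5 v6 v7 v8 v9 v10 v11 v12 v13 v14 : K) :
    leftE₂ l m x
      ![v0, v1, v2, v3, v4, v5, v6, v7, v8, v9, v10, v11, v12, v13, v14] =
    ![0, 0, 0, 0,
      v0 + l⁻¹ * v2 + x * v4 + l * v6 + m * v9 + v10, 0, 0, 0, 0, 0, 0,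
      v1 + l⁻¹ * v7 + v9 + x * v11 + l * v14,
      v3 + v5 + l⁻¹ * v8 - m * v9 + x * v12 + l⁻¹ * v13, 0, 0] :=
  rfl

theorem relations_left {l m x : K} (p : Parameters l m x) :
    Relations l m (leftG₁ l m) (leftG₂ l m) (leftE₁ l m x) (leftE₂ l m x) := by
  have hl := p.l_ne_zero
  have hm := p.m_ne_zero
  have hx : x = 1 - (l - l⁻¹) / m := by
    have := p.mul_one_sub
    field_simp at this ⊢
    linear_combination -this
  subst hx
  constructor <;> refine LinearMap.ext fun v => ?_ <;> rw [eq_vec v] <;>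
    simp only [leftG₁_vec, leftG₂_vec, leftE₁_vec, leftE₂_vec, Module.End.mul_apply,
      LinearMap.smul_apply, LinearMap.sub_apply, LinearMap.add_apply, Module.End.one_apply,
      Matrix.smul_cons, Matrix.sub_cons, Matrix.add_cons, Matrix.head_cons, Matrix.tail_cons,
      Matrix.smul_empty, Matrix.empty_sub_empty, Matrix.empty_add_empty, smul_eq_mul,
      Matrix.vecCons_inj, and_true] <;>
    refine ⟨?_, ?_, ?_, ?_, ?_, ?_, ?_, ?_, ?_, ?_, ?_, ?_, ?_, ?_, ?_⟩ <;>
    first | exact True.intro | ring1 | (field_simp; ring1)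

variable {A : Type*} [Ring A] [Algebra K A]

theorem linearCombination_monomials (g₁ g₂ e₁ e₂ : A)
    (v0 v1 v2 v3 v4 v5 v6 v7 v8 v9 v10 v11 v12 v13 v14 : K) :
    Fintype.linearCombination K (monomials g₁ g₂ e₁ e₂)
      ![v0, v1, v2, v3, v4, v5, v6, v7, v8, v9, v10, v11, v12, v13, v14] =
    v0 • 1 + v1 • g₁ + v2 • g₂ + v3 • e₁ + v4 • e₂ + v5 • (g₁ * g₂) + v6 • (g₁ * e₂) +
      v7 • (g₂ * g₁) + v8 • (g₂ * e₁) + v9 • (e₁ * g₂) + v10 • (e₁ * e₂) + v11 • (e₂ * g₁) +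
      v12 • (e₂ * e₁) + v13 • (g₁ * g₂ * g₁) + v14 • (g₁ * e₂ * g₁) := by
  simp only [Fintype.linearCombination_apply, Fin.sum_univ_succ, monomials, Matrix.cons_val_zero,
    Matrix.cons_val_succ, Finset.univ_eq_empty, Finset.sum_empty, add_zero, add_assoc]

theorem Relations.g₁_mul_linearCombination {l m x : K} {g₁ g₂ e₁ e₂ : A}
    (h : Relations l m g₁ g₂ e₁ e₂) (p : Parameters l m x) (v : Fin 15 → K) :
    g₁ * Fintype.linearCombination K (monomials g₁ g₂ e₁ e₂) v =
      Fintype.linearCombination K (monomials g₁ g₂ e₁ e₂) (leftG₁ l m v) := by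
  have gg (a : A) : g₁ * (g₁ * a) = a - m • (g₁ * a) + (m * l⁻¹) • (e₁ * a) := by
    rw [← mul_assoc, h.g_mul_g p]
    simp only [add_mul, sub_mul, one_mul, smul_mul_assoc]
  have ge (a : A) : g₁ * (e₁ * a) = l⁻¹ • (e₁ * a) := by
    rw [← mul_assoc, h.ge₁, smul_mul_assoc]
  have egg := h.egg p
  have gge := h.gge_eq p
  have gee := h.gee p
  have eeg := h.eeg p
  rw [mul_assoc] at egg gge gee eeg
  rw [eq_vec v, leftG₁_vec, linearCombination_monomials, linearCombination_monomials]
  simp only [mul_add, mul_smul_comm, mul_one, mul_assoc, h.g_mul_g p, gg, h.ge₁, ge, egg, gge, gee,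
    eeg]
  module

theorem Relations.g₂_mul_linearCombination {l m x : K} {g₁ g₂ e₁ e₂ : A}
    (h : Relations l m g₁ g₂ e₁ e₂) (p : Parameters l m x) (v : Fin 15 → K) :
    g₂ * Fintype.linearCombination K (monomials g₁ g₂ e₁ e₂) v =
      Fintype.linearCombination K (monomials g₁ g₂ e₁ e₂) (leftG₂ l m v) := by
  have gg (a : A) : g₂ * (g₂ * a) = a - m • (g₂ * a) + (m * l⁻¹) • (e₂ * a) := by
    rw [← mul_assoc, h.symm.g_mul_g p]
    simp only [add_mul, sub_mul, one_mul, smul_mul_assoc]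
  have ge (a : A) : g₂ * (e₂ * a) = l⁻¹ • (e₂ * a) := by
    rw [← mul_assoc, h.symm.ge₁, smul_mul_assoc]
  have ggg : g₂ * (g₁ * g₂) = g₁ * (g₂ * g₁) := by simpa only [mul_assoc] using h.braid.symm
  have gggg : g₂ * (g₁ * (g₂ * g₁)) = g₁ * g₂ - m • (g₁ * (g₂ * g₁)) + (m * l⁻¹) • (e₂ * e₁) := by
    rw [← h.gge_eq p, ← mul_assoc g₁, ← mul_assoc, ← mul_assoc g₂, ← h.braid, mul_assoc _ g₁,
      h.g_mul_g p]
    simp only [mul_add, mul_sub, mul_one, mul_smul_comm, mul_assoc]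
  have geg := h.geg p
  have gge := h.symm.gge_eq p
  have gee := h.symm.gee p
  have eeg := h.eeg p
  have gegg : g₂ * (g₁ * (e₂ * g₁)) = e₁ * g₂ - m • (e₁ * e₂) + m • e₁ := by
    rw [← eeg, ← gge]; simp only [mul_assoc]
  simp only [mul_assoc] at geg gge gee eeg
  rw [eq_vec v, leftG₂_vec, linearCombination_monomials, linearCombination_monomials]
  simp only [mul_add, mul_smul_comm, mul_one, mul_assoc, h.symm.g_mul_g p, gg, h.ge₂, ge, ggg, gggg,
    geg, gge, gee, gegg]
  module

theorem linearCombination_left_apply (l m x : K) (v : Fin 15 → K) :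
    Fintype.linearCombination K
      (monomials (leftG₁ l m) (leftG₂ l m) (leftE₁ l m x) (leftE₂ l m x)) v
      ![1, 0, 0, 0, 0, 0, 0, 0, 0, 0, 0, 0, 0, 0, 0] = v := by
  rw [eq_vec v, linearCombination_monomials]
  simp only [leftG₁_vec, leftG₂_vec, leftE₁_vec, leftE₂_vec, Module.End.mul_apply,
    LinearMap.smul_apply, LinearMap.add_apply, Module.End.one_apply,
    Matrix.smul_cons, Matrix.add_cons, Matrix.head_cons, Matrix.tail_cons,
    Matrix.smul_empty, Matrix.empty_add_empty, smul_eq_mul, mul_zero, mul_one, add_zero, zero_add,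
    sub_zero]

end Table

theorem algebraMap_ne_zero_of_eval {p : MvPolynomial (Fin 2) ℚ}
    (hp : MvPolynomial.eval ![2, 0] p ≠ 0) : algebraMap _ BMWField p ≠ 0 := by
  rw [Ne, FaithfulSMul.algebraMap_eq_zero_iff]
  rintro rfl
  exact hp (map_zero _)

theorem parameters : Parameters lP mP xP := by
  have hl : lP ≠ 0 := algebraMap_ne_zero_of_eval (by simp)
  have hx : 1 - xP ≠ 0 := by
    have := algebraMap_ne_zero_of_eval (p := 1 - MvPolynomial.X 1) (by simp)
    rwa [map_sub, map_one] at this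
  have hll : lP ^ 2 - 1 ≠ 0 := by
    have := algebraMap_ne_zero_of_eval (p := MvPolynomial.X 0 ^ 2 - 1) (by norm_num)
    rwa [map_sub, map_one, map_pow] at this
  have hlx : lP ^ 2 - xP ≠ 0 := by
    have := algebraMap_ne_zero_of_eval (p := MvPolynomial.X 0 ^ 2 - MvPolynomial.X 1) (by norm_num)
    rwa [map_sub, map_pow] at this
  have hm : mP = (lP ^ 2 - 1) / (lP * (1 - xP)) := by
    rw [mP]; field_simp
  refine ⟨hl, ?_, ?_, ?_⟩
  · rw [hm]
    exact div_ne_zero hll (mul_ne_zero hl hx)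
  · have : mP + lP⁻¹ = (lP ^ 2 - xP) / (lP * (1 - xP)) := by
      rw [hm]; field_simp; ring
    rw [this]
    exact div_ne_zero hlx (mul_ne_zero hl hx)
  · rw [mP, div_mul_cancel₀ _ hx]

theorem relations_generators :
    Relations lP mP (gg 2 adjA2 0) (gg 2 adjA2 1) (ee 2 adjA2 0) (ee 2 adjA2 1) := by
  have h₀₁ : adjA2 0 1 := by simp [adjA2]
  have h₁₀ : adjA2 1 0 := by simp [adjA2]
  have key {a b : BMWFree 2} (h : BMWRel 2 adjA2 a b) :=
    RingQuot.mkAlgHom_rel BMWField h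
  constructor
  · simpa [gg, ee] using key (.braid 0 1 h₀₁)
  · simpa [gg, ee] using key (.defE 0)
  · simpa [gg, ee] using key (.defE 1)
  · simpa [gg, ee] using key (.ge 0)
  · simpa [gg, ee] using key (.ge 1)
  · simpa [gg, ee] using key (.ege 0 1 h₀₁)
  · simpa [gg, ee] using key (.ege 1 0 h₁₀)

/-- The representation of the BMW algebra of type `A₂` given by elements satisfying the defining
relations. -/
def lift {A : Type*} [Ring A] [Algebra BMWField A] {g₁ g₂ e₁ e₂ : A}
    (h : Relations lP mP g₁ g₂ e₁ e₂) : BMW 2 adjA2 →ₐ[BMWField] A :=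
  RingQuot.liftAlgHom BMWField ⟨FreeAlgebra.lift BMWField (Sum.elim ![g₁, g₂] ![e₁, e₂]), by
    rintro _ _ (⟨i, j, hne, hadj⟩ | ⟨i, j, hadj⟩ | i | i | ⟨i, j, hadj⟩)
    · exact absurd hne hadj
    · fin_cases i <;> fin_cases j <;> simp [adjA2, Gf] at hadj ⊢
      exacts [h.braid, h.braid.symm]
    · fin_cases i <;> simp [Gf, Ef]
      exacts [h.smul_e₁, h.smul_e₂]
    · fin_cases i <;> simp [Gf, Ef]
      exacts [h.ge₁, h.ge₂]
    · fin_cases i <;> fin_cases j <;> simp [adjA2, Gf, Ef] at hadj ⊢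
      exacts [h.ege₁, h.ege₂]⟩

theorem lift_a2Basis {A : Type*} [Ring A] [Algebra BMWField A] {g₁ g₂ e₁ e₂ : A}
    (h : Relations lP mP g₁ g₂ e₁ e₂) : lift h ∘ a2Basis = monomials g₁ g₂ e₁ e₂ := by
  have hg₁ : lift h (gg 2 adjA2 0) = g₁ := by simp [lift, gg, Gf]
  have hg₂ : lift h (gg 2 adjA2 1) = g₂ := by simp [lift, gg, Gf]
  have he₁ : lift h (ee 2 adjA2 0) = e₁ := by simp [lift, ee, Ef]
  have he₂ : lift h (ee 2 adjA2 1) = e₂ := by simp [lift, ee, Ef]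
  funext i
  fin_cases i <;> simp [a2Basis, monomials, hg₁, hg₂, he₁, he₂]

theorem linearIndependent_a2Basis : LinearIndependent BMWField a2Basis := by
  apply LinearIndependent.of_comp (lift (relations_left parameters)).toLinearMap
  rw [AlgHom.coe_toLinearMap, lift_a2Basis, linearIndependent_iff_injective_fintypeLinearCombination]
  intro v w hvw
  rw [← linearCombination_left_apply lP mP xP v, hvw, linearCombination_left_apply]

theorem adjoin_generators :
    Algebra.adjoin BMWField {gg 2 adjA2 0, gg 2 adjA2 1} = ⊤ := by
  set S := Algebra.adjoin BMWField {gg 2 adjA2 0, gg 2 adjA2 1}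
  have h := relations_generators
  have hg₁ : gg 2 adjA2 0 ∈ S := Algebra.subset_adjoin (by simp)
  have hg₂ : gg 2 adjA2 1 ∈ S := Algebra.subset_adjoin (by simp)
  rw [← top_le_iff, ← (AlgHom.range_eq_top _).2 (RingQuot.mkAlgHom_surjective BMWField _),
    ← Algebra.map_top, ← FreeAlgebra.adjoin_range_ι, AlgHom.map_adjoin, Algebra.adjoin_le_iff]
  rintro _ ⟨_, ⟨i | i, rfl⟩, rfl⟩ <;> fin_cases i
  exacts [hg₁, hg₂, h.e_mem parameters hg₁, h.symm.e_mem parameters hg₂]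

theorem span_a2Basis : Submodule.span BMWField (Set.range a2Basis) = ⊤ := by
  have h := relations_generators
  rw [← Fintype.range_linearCombination, eq_top_iff]
  set φ := Fintype.linearCombination BMWField a2Basis
  suffices H : ∀ a : BMW 2 adjA2, ∀ b ∈ LinearMap.range φ, a * b ∈ LinearMap.range φ by
    intro a _
    refine mul_one a ▸ H a 1 ⟨Pi.single 0 1, ?_⟩
    simp [φ, a2Basis]
  intro a
  have ha : a ∈ Algebra.adjoin BMWField {gg 2 adjA2 0, gg 2 adjA2 1} :=
    adjoin_generators ▸ Algebra.mem_top
  induction ha using Algebra.adjoin_induction with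
  | mem a ha =>
    rintro _ ⟨v, rfl⟩
    rcases ha with rfl | rfl
    · exact ⟨_, (h.g₁_mul_linearCombination parameters v).symm⟩
    · exact ⟨_, (h.g₂_mul_linearCombination parameters v).symm⟩
  | algebraMap c =>
    intro b hb
    rw [← Algebra.smul_def]
    exact Submodule.smul_mem _ c hb
  | add a a' _ _ ha ha' =>
    intro b hb
    rw [add_mul]
    exact add_mem (ha b hb) (ha' b hb)
  | mul a a' _ _ ha ha' =>
    intro b hb
    rw [mul_assoc]
    exact ha _ (ha' b hb)

end BMWA2

/-- The BMW algebra of type `A₂` has dimension 15 over ℚ(l,x), with the 15 listed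
monomials as a basis. -/
theorem bmw_A2_dim_fifteen :
    Module.finrank BMWField (BMW 2 adjA2) = 15 ∧
    LinearIndependent BMWField a2Basis ∧
    Submodule.span BMWField (Set.range a2Basis) = ⊤ :=
  ⟨by rw [← finrank_top, ← BMWA2.span_a2Basis,
      finrank_span_eq_card BMWA2.linearIndependent_a2Basis, Fintype.card_fin],
    BMWA2.linearIndependent_a2Basis, BMWA2.span_a2Basis⟩
end
end
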